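/- arXiv:1804.02532 — 2 statements merged into one kernel-verified Lean document; each statement's English description precedes it below -/
import Mathlib

section
/- In the Knödel graph W_{Δ,n} with Δ ≥ 2, if Δ < log₂(n/2 + 2) (equivalently 2^Δ − 2 < n/2), then for all 1 ≤ i < j ≤ n/2 the vertices u_i and u_j satisfy |N(u_i) ∩ N(u_j)| ≤ 1. -/
/-- The Knödel graph `W_{Δ,n}` (here `m = n/2`): a bipartite graph on the vertex set
`Bool × ZMod m`, where `(false, i)` plays the role of `u_i` and `(true, j)` the role of `v_j`,
and `u_i` is adjacent to `v_j` iff `j ≡ i + 2^k - 1 (mod m)` for some `0 ≤ k ≤ Δ - 1`. -/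
def knodel (Δ m : ℕ) : SimpleGraph (Bool × ZMod m) :=
  SimpleGraph.fromRel (fun a b =>
    a.1 = false ∧ b.1 = true ∧ ∃ k < Δ, b.2 = a.2 + 2 ^ k - 1)

/-- The index-distance between (the indices of) two vertices `u_i` and `u_j`
of the Knödel graph on `2m` vertices: `id(u_i,u_j) = min{|i-j|, m - |i-j|}`. -/
def idist (m i j : ℕ) : ℕ := min (Nat.dist i j) (m - Nat.dist i j)

/-- The set `M_Δ = {2^a - 2^b : 0 ≤ b < a ≤ Δ - 1}`. -/
def Mset (Δ : ℕ) : Set ℕ := {x | ∃ a b : ℕ, b < a ∧ a < Δ ∧ x = 2 ^ a - 2 ^ b}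

theorem two_pow_add_two_pow_le_two_pow {a b c : ℕ} (ha : a < c) (hb : b < c) :
    2 ^ a + 2 ^ b ≤ 2 ^ c := by
  have h₁ : 2 ^ (a + 1) ≤ 2 ^ c := Nat.pow_le_pow_right two_pos ha
  have h₂ : 2 ^ (b + 1) ≤ 2 ^ c := Nat.pow_le_pow_right two_pos hb
  omega

theorem eq_or_eq_of_two_pow_add_two_pow_eq {a b c d : ℕ}
    (h : 2 ^ a + 2 ^ d = 2 ^ b + 2 ^ c) : a = b ∨ a = c := by
  have mono_le {x y : ℕ} (hxy : x ≤ y) : 2 ^ x ≤ 2 ^ y := Nat.pow_le_pow_right two_pos hxy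
  have mono_lt {x y : ℕ} (hxy : x < y) : 2 ^ x < 2 ^ y := Nat.pow_lt_pow_right one_lt_two hxy
  have pos (x : ℕ) : 0 < 2 ^ x := Nat.two_pow_pos x
  have := pos a
  have := pos b
  have := pos c
  have := pos d
  rcases lt_trichotomy a b with hab | hab | hab
  · rcases lt_trichotomy a c with hac | hac | hac
    · have := mono_lt hab
      have := mono_lt hac
      rcases le_or_gt d b with hdb | hdb
      · have := mono_le hdb
        omega
      · rcases le_or_gt d c with hdc | hdc
        · have := mono_le hdc
          omega
        · have := two_pow_add_two_pow_le_two_pow hdb hdc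
          omega
    · exact Or.inr hac
    · rcases lt_or_ge d b with hdb | hdb
      · have := two_pow_add_two_pow_le_two_pow hab hdb
        omega
      · have := mono_le hdb
        have := mono_lt hac
        omega
  · exact Or.inl hab
  · rcases lt_trichotomy a c with hac | hac | hac
    · rcases lt_or_ge d c with hdc | hdc
      · have := two_pow_add_two_pow_le_two_pow hac hdc
        omega
      · have := mono_le hdc
        have := mono_lt hab
        omega
    · exact Or.inr hac
    · have := two_pow_add_two_pow_le_two_pow hab hac
      omega

/-- If `2 ^ Δ - 2 < m`, sums of two powers of two with exponents below `Δ` that are congruent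
modulo `m` are equal. -/
theorem two_pow_add_two_pow_eq_of_cast_eq {Δ m a b c d : ℕ} (hm : 2 ^ Δ < m + 2)
    (ha : a < Δ) (hb : b < Δ) (hc : c < Δ) (hd : d < Δ)
    (h : (2 : ZMod m) ^ a + 2 ^ d = 2 ^ b + 2 ^ c) : 2 ^ a + 2 ^ d = 2 ^ b + 2 ^ c := by
  have hmod : 2 ^ a + 2 ^ d ≡ 2 ^ b + 2 ^ c [MOD m] := by
    rw [← ZMod.natCast_eq_natCast_iff]
    exact_mod_cast h
  have := two_pow_add_two_pow_le_two_pow ha hd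
  have := two_pow_add_two_pow_le_two_pow hb hc
  have pos (x : ℕ) : 0 < 2 ^ x := Nat.two_pow_pos x
  have := pos a
  have := pos b
  have := pos c
  have := pos d
  exact hmod.eq_of_abs_lt (by rw [abs_lt]; omega)

theorem knodel_adj_false_iff {Δ m : ℕ} {x : ZMod m} {w : Bool × ZMod m} :
    (knodel Δ m).Adj (false, x) w ↔ w.1 = true ∧ ∃ k < Δ, w.2 = x + 2 ^ k - 1 := by
  obtain ⟨s, y⟩ := w
  cases s <;> simp [knodel, SimpleGraph.fromRel_adj]

theorem natCast_zmod_ne {m i j : ℕ} (hi : 1 ≤ i) (hij : i < j) (hj : j ≤ m) :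
    (i : ZMod m) ≠ j := fun h => by
  rw [ZMod.natCast_eq_natCast_iff] at h
  have := h.eq_of_abs_lt (by rw [abs_lt]; omega)
  omega

/-- Lemma 3 (i): in `W_{Δ,n}` with `Δ ≥ 2` and `Δ < log₂(n/2 + 2)` (equivalently
`2^Δ - 2 < n/2`), any two distinct vertices `u_i, u_j` with `1 ≤ i < j ≤ n/2` have at most one
common neighbor. -/
theorem knodel_stmt_8 (n Δ : ℕ) (hn : Even n) (hn2 : 2 ≤ n)
    (hΔ : 2 ≤ Δ) (hΔ' : Δ ≤ Nat.log 2 n) (hsmall : 2 ^ Δ < n / 2 + 2) :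
    ∀ i j : ℕ, 1 ≤ i → i < j → j ≤ n / 2 →
      ((knodel Δ (n / 2)).neighborSet (false, (i : ZMod (n / 2))) ∩
        (knodel Δ (n / 2)).neighborSet (false, (j : ZMod (n / 2)))).ncard ≤ 1 := by
  intro i j hi hij hj
  have : NeZero (n / 2) := ⟨by omega⟩
  rw [Set.ncard_le_one_iff_subsingleton]
  rintro ⟨s, y⟩ ⟨hy₁, hy₂⟩ ⟨t, z⟩ ⟨hz₁, hz₂⟩
  rw [SimpleGraph.mem_neighborSet, knodel_adj_false_iff] at hy₁ hy₂ hz₁ hz₂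
  obtain ⟨hs, a, ha, hya⟩ := hy₁
  obtain ⟨-, b, hb, hyb⟩ := hy₂
  obtain ⟨ht, c, hc, hzc⟩ := hz₁
  obtain ⟨-, d, hd, hzd⟩ := hz₂
  dsimp only at hs ht hya hyb hzc hzd
  have hsum := two_pow_add_two_pow_eq_of_cast_eq hsmall ha hb hc hd
    (by linear_combination hyb - hya + hzc - hzd)
  rcases eq_or_eq_of_two_pow_add_two_pow_eq hsum with rfl | rfl
  · exact absurd (by linear_combination hyb - hya) (natCast_zmod_ne hi hij hj)
  · rw [hs, ht, hya, hzc]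
end

section
/- For every integer t ≥ 1, the total domination number of the cubic Knödel graph W_{3,10t+4} equals 4t + 2. -/
/-- The total domination number of a graph `G`: the minimum cardinality of a (finite) set `D`
of vertices such that every vertex of `G` has a neighbor in `D`. -/
noncomputable def totalDominationNumber {V : Type*} (G : SimpleGraph V) : ℕ :=
  sInf {k | ∃ D : Set V, D.Finite ∧ D.ncard = k ∧ ∀ v, ∃ d ∈ D, G.Adj v d}

/-- A potential on the `0`-`1` words of length three recording which of three consecutive residues
lie in a set; it amortizes the gaps of a covering set. -/
def windowPotential : Bool → Bool → Bool → ℤ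
  | false, false, false => -6
  | false, false, true => -3
  | false, true, false => -5
  | false, true, true => 0
  | true, false, false => -4
  | true, false, true => -2
  | true, true, false => -2
  | true, true, true => 0

theorem windowPotential_step (a b c d : Bool) (h : d = true ∨ c = true ∨ a = true) :
    windowPotential b c d - windowPotential a b c ≤ 5 * (if d = true then 1 else 0) - 2 := by
  revert a b c d
  decide

/-- The translates of `{0, 1, 3}` by a set `S` can cover `ZMod m` only if `S` has density at
least `2 / 5`. -/
theorem two_mul_le_five_mul_card_of_cover {m : ℕ} [NeZero m] (S : Finset (ZMod m))
    (h : ∀ x, x ∈ S ∨ x - 1 ∈ S ∨ x - 3 ∈ S) : 2 * m ≤ 5 * S.card := by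
  let s : ZMod m → Bool := fun x => decide (x ∈ S)
  let φ : ZMod m → ℤ := fun x => windowPotential (s (x - 2)) (s (x - 1)) (s x)
  have step (x : ZMod m) : φ x - φ (x - 1) ≤ 5 * (if x ∈ S then 1 else 0) - 2 := by
    have hx := windowPotential_step (s (x - 3)) (s (x - 2)) (s (x - 1)) (s x)
      (by simpa [s] using h x)
    have e₁ : x - 1 - 1 = x - 2 := by ring
    have e₂ : x - 1 - 2 = x - 3 := by ring
    simpa [φ, e₁, e₂, s] using hx
  have total := Finset.sum_le_sum fun x (_ : x ∈ Finset.univ) => step x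
  have shift : ∑ x, φ (x - 1) = ∑ x, φ x := Equiv.sum_comp (Equiv.subRight (1 : ZMod m)) φ
  rw [Finset.sum_sub_distrib, shift, sub_self, Finset.sum_sub_distrib, ← Finset.mul_sum] at total
  simp [ZMod.card] at total
  omega

theorem knodel_three_adj_false_true {m : ℕ} (i j : ZMod m) :
    (knodel 3 m).Adj (false, i) (true, j) ↔ j = i ∨ j = i + 1 ∨ j = i + 3 := by
  have e₁ : i + 2 - 1 = i + 1 := by ring
  have e₂ : i + 2 ^ 2 - 1 = i + 3 := by ring
  simp only [knodel, SimpleGraph.fromRel_adj]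
  constructor
  · rintro ⟨-, ⟨-, -, k, hk, h⟩ | ⟨h, -⟩⟩
    · interval_cases k <;> simp_all
    · simp at h
  · rintro (h | h | h)
    · exact ⟨by simp, Or.inl ⟨trivial, trivial, 0, by simp, by simp [h]⟩⟩
    · exact ⟨by simp, Or.inl ⟨trivial, trivial, 1, by simp, by simp [h, e₁]⟩⟩
    · exact ⟨by simp, Or.inl ⟨trivial, trivial, 2, by simp, by simp [h, e₂]⟩⟩

theorem knodel_not_adj_of_fst_eq {Δ m : ℕ} (b : Bool) (i j : ZMod m) :
    ¬ (knodel Δ m).Adj (b, i) (b, j) := by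
  cases b <;> simp [knodel, SimpleGraph.fromRel_adj]

theorem knodel_three_dominates_true_iff {m : ℕ} (D : Set (Bool × ZMod m)) (j : ZMod m) :
    (∃ d ∈ D, (knodel 3 m).Adj (true, j) d) ↔
      (false, j) ∈ D ∨ (false, j - 1) ∈ D ∨ (false, j - 3) ∈ D := by
  constructor
  · rintro ⟨⟨b, i⟩, hd, hadj⟩
    cases b
    · rw [SimpleGraph.adj_comm, knodel_three_adj_false_true] at hadj
      rcases hadj with rfl | rfl | rfl <;> simp [hd]
    · exact absurd hadj (knodel_not_adj_of_fst_eq _ _ _)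
  · rintro (h | h | h) <;> refine ⟨_, h, ?_⟩ <;>
      rw [SimpleGraph.adj_comm, knodel_three_adj_false_true] <;> simp

theorem knodel_three_dominates_false_iff {m : ℕ} (D : Set (Bool × ZMod m)) (i : ZMod m) :
    (∃ d ∈ D, (knodel 3 m).Adj (false, i) d) ↔
      (true, i) ∈ D ∨ (true, i + 1) ∈ D ∨ (true, i + 3) ∈ D := by
  constructor
  · rintro ⟨⟨b, j⟩, hd, hadj⟩
    cases b
    · exact absurd hadj (knodel_not_adj_of_fst_eq _ _ _)
    · rw [knodel_three_adj_false_true] at hadj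
      rcases hadj with rfl | rfl | rfl <;> simp [hd]
  · rintro (h | h | h) <;> refine ⟨_, h, ?_⟩ <;>
      rw [knodel_three_adj_false_true] <;> simp

theorem four_mul_add_two_le_ncard_of_dominates (t : ℕ) (D : Set (Bool × ZMod (5 * t + 2)))
    (hD : ∀ v, ∃ d ∈ D, (knodel 3 (5 * t + 2)).Adj v d) : 4 * t + 2 ≤ D.ncard := by
  classical
  have hfalse := two_mul_le_five_mul_card_of_cover {i | (false, i) ∈ D} fun x => by
    simpa using (knodel_three_dominates_true_iff D x).1 (hD _)
  have htrue := two_mul_le_five_mul_card_of_cover {i | (true, -i) ∈ D} fun x => by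
    have := (knodel_three_dominates_false_iff D (-x)).1 (hD _)
    simpa [add_comm, sub_eq_add_neg] using this
  have hneg : ({i | (true, -i) ∈ D} : Finset (ZMod (5 * t + 2))).card =
      ({i | (true, i) ∈ D} : Finset (ZMod (5 * t + 2))).card := by
    simp only [Finset.card_filter]
    exact Equiv.sum_comp (Equiv.neg _) fun i => if (true, i) ∈ D then 1 else 0
  have hcard : D.ncard = ({i | (true, i) ∈ D} : Finset (ZMod (5 * t + 2))).card +
      ({i | (false, i) ∈ D} : Finset (ZMod (5 * t + 2))).card := by
    rw [Set.ncard_eq_toFinset_card', ← Set.filter_mem_univ_eq_toFinset]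
    simp only [Finset.card_filter, Fintype.sum_prod_type, Fintype.sum_bool]
  omega

/-- The residues `0, 1, 5, 6, 10, 11, …, 5 * t` modulo `5 * t + 2`, whose translates by
`{0, 1, 3}` cover everything. -/
def coverSet (t : ℕ) : Finset (ZMod (5 * t + 2)) :=
  (Finset.range (2 * t + 1)).image fun i => ((5 * (i / 2) + i % 2 : ℕ) : ZMod (5 * t + 2))

theorem card_coverSet_le (t : ℕ) : (coverSet t).card ≤ 2 * t + 1 :=
  Finset.card_image_le.trans (Finset.card_range _).le

theorem natCast_mem_coverSet {t n : ℕ} (hn : n ≤ 5 * t) (h : n % 5 ≤ 1) :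
    (n : ZMod (5 * t + 2)) ∈ coverSet t := by
  refine Finset.mem_image.2 ⟨2 * (n / 5) + n % 5, Finset.mem_range.2 (by omega), ?_⟩
  congr 1
  omega

theorem coverSet_covers (t : ℕ) (x : ZMod (5 * t + 2)) :
    x ∈ coverSet t ∨ x - 1 ∈ coverSet t ∨ x - 3 ∈ coverSet t := by
  obtain ⟨n, hn, rfl⟩ : ∃ n < 5 * t + 2, (n : ZMod (5 * t + 2)) = x :=
    ⟨x.val, x.val_lt, x.natCast_zmod_val⟩
  by_cases h₀ : n % 5 = 0 ∨ n % 5 = 1 ∧ n ≤ 5 * t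
  · exact Or.inl (natCast_mem_coverSet (by omega) (by omega))
  by_cases h₁ : n % 5 ≤ 2
  · refine Or.inr (Or.inl ?_)
    have := natCast_mem_coverSet (t := t) (n := n - 1) (by omega) (by omega)
    rwa [Nat.cast_sub (by omega), Nat.cast_one] at this
  · refine Or.inr (Or.inr ?_)
    have := natCast_mem_coverSet (t := t) (n := n - 3) (by omega) (by omega)
    rwa [Nat.cast_sub (by omega), Nat.cast_ofNat] at this

theorem exists_dominating_ncard_le (t : ℕ) : ∃ D : Set (Bool × ZMod (5 * t + 2)),
    D.ncard ≤ 4 * t + 2 ∧ ∀ v, ∃ d ∈ D, (knodel 3 (5 * t + 2)).Adj v d := by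
  let E : Finset (Bool × ZMod (5 * t + 2)) :=
    (coverSet t).image (fun i => (false, i)) ∪ (coverSet t).image (fun i => (true, -i))
  have hfalse (i) : (false, i) ∈ (E : Set (Bool × ZMod (5 * t + 2))) ↔ i ∈ coverSet t := by
    simp [E]
  have htrue (i) : (true, i) ∈ (E : Set (Bool × ZMod (5 * t + 2))) ↔ -i ∈ coverSet t := by
    simp [E, neg_eq_iff_eq_neg]
  refine ⟨E, ?_, ?_⟩
  · rw [Set.ncard_coe_finset]
    dsimp only [E]
    have := Finset.card_union_le ((coverSet t).image fun i => (false, i))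
      ((coverSet t).image fun i => (true, -i))
    have := (coverSet t).card_image_le (f := fun i => (false, i))
    have := (coverSet t).card_image_le (f := fun i => (true, -i))
    have := card_coverSet_le t
    omega
  · rintro ⟨_ | _, i⟩
    · rw [knodel_three_dominates_false_iff]
      simp only [htrue]
      simpa [add_comm, sub_eq_add_neg] using coverSet_covers t (-i)
    · rw [knodel_three_dominates_true_iff]
      simp only [hfalse]
      exact coverSet_covers t i

/-- Case 3: for every `t ≥ 1`, the total domination number of `W_{3,10t+4}` equals `4t + 2`. -/
theorem knodel_stmt_15 (t : ℕ) (ht : 1 ≤ t) :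
    totalDominationNumber (knodel 3 ((10 * t + 4) / 2)) = 4 * t + 2 := by
  have hm : (10 * t + 4) / 2 = 5 * t + 2 := by omega
  rw [hm]
  obtain ⟨D, hcard, hD⟩ := exists_dominating_ncard_le t
  apply le_antisymm
  · exact le_trans (Nat.sInf_le ⟨D, D.toFinite, rfl, hD⟩) hcard
  · refine le_csInf ⟨_, D, D.toFinite, rfl, hD⟩ ?_
    rintro k ⟨D', -, rfl, hD'⟩
    exact four_mul_add_two_le_ncard_of_dominates t D' hD'
end
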